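/- Let U ⊆ ℝ² be open and connected, let f : U × ℝ² → ℝ be smooth and λ ∈ ℝ, and suppose the gradient Ricci soliton equation Hes_f(∂_a, ∂_b) + ρ_{ab} = λ g_{ab} holds on U × ℝ² for all a, b ∈ {1, 2, 1', 2'}, where Hes_f(∂_a,∂_b) = ∂_a∂_b f − Σ_c 𝚪^c_{ab} ∂_c f and ρ_{ab} is the Ricci tensor of g_{D,Φ}. Then ∂²f/∂x_{i'}∂x_{j'} = 0 for all i, j, and consequently there exist smooth functions X¹, X², h : U → ℝ such that f(x¹, x², x₁', x₂') = x₁' X¹(x¹, x²) + x₂' X²(x¹, x²) + h(x¹, x²). -/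

import Mathlib

noncomputable section

/-- Points of the affine surface `Σ` (local coordinates `(x¹,x²)`). -/
abbrev Pt2 := Fin 2 → ℝ
/-- Points of the cotangent bundle `T*Σ` (coordinates `(x¹,x²,x₁',x₂')`). -/
abbrev Pt4 := Fin 4 → ℝ

/-- Projection to the base coordinates. -/
def base (p : Pt4) : Pt2 := ![p 0, p 1]

/-- Unprimed index `i ∈ {1,2}` as an index in `{1,2,1',2'}`. -/
def unp (i : Fin 2) : Fin 4 := ⟨i.1, by omega⟩
/-- Primed index `i' ∈ {1',2'}` as an index in `{1,2,1',2'}`. -/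
def pr (i : Fin 2) : Fin 4 := ⟨i.1 + 2, by omega⟩

/-- Partial derivative `∂_{x^i}` on the surface. -/
def pd2 (i : Fin 2) (f : Pt2 → ℝ) (p : Pt2) : ℝ :=
  fderiv ℝ f p (Pi.single i 1)

/-- Partial derivative `∂_a` on the cotangent bundle. -/
def pd4 (a : Fin 4) (f : Pt4 → ℝ) (p : Pt4) : ℝ :=
  fderiv ℝ f p (Pi.single a 1)

/-- The component `𝚪^{k'}_{ij}` of the Levi-Civita connection of a deformed
Riemannian extension. -/
def GammaPr (Γ : Fin 2 → Fin 2 → Fin 2 → Pt2 → ℝ) (Φ : Fin 2 → Fin 2 → Pt2 → ℝ)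
    (k i j : Fin 2) (p : Pt4) : ℝ :=
  (∑ r : Fin 2, p (pr r) *
      (pd2 k (Γ r i j) (base p) - pd2 i (Γ r j k) (base p) - pd2 j (Γ r i k) (base p)
        + 2 * ∑ l : Fin 2, Γ r k l (base p) * Γ l i j (base p)))
    + (1 / 2) * (pd2 i (Φ j k) (base p) + pd2 j (Φ i k) (base p) - pd2 k (Φ i j) (base p))
    - ∑ l : Fin 2, Φ k l (base p) * Γ l i j (base p)

/-- The Christoffel symbols `𝚪^a_{bc}` of the Levi-Civita connection of the deformed
Riemannian extension `g_{D,Φ}`:  `𝚪^k_{ij} = Γ^k_{ij}`, `𝚪^{k'}_{i'j} = 𝚪^{k'}_{j i'} = −Γ^i_{jk}`,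
`𝚪^{k'}_{ij} = GammaPr`, and all other coefficients zero. -/
def GG (Γ : Fin 2 → Fin 2 → Fin 2 → Pt2 → ℝ) (Φ : Fin 2 → Fin 2 → Pt2 → ℝ)
    (a b c : Fin 4) (p : Pt4) : ℝ :=
  if ha : a.1 < 2 then
    if hb : b.1 < 2 then
      if hc : c.1 < 2 then Γ ⟨a.1, ha⟩ ⟨b.1, hb⟩ ⟨c.1, hc⟩ (base p) else 0
    else 0
  else
    if hb : b.1 < 2 then
      if hc : c.1 < 2 then GammaPr Γ Φ ⟨a.1 - 2, by omega⟩ ⟨b.1, hb⟩ ⟨c.1, hc⟩ p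
      else -Γ ⟨c.1 - 2, by omega⟩ ⟨b.1, hb⟩ ⟨a.1 - 2, by omega⟩ (base p)
    else
      if hc : c.1 < 2 then -Γ ⟨b.1 - 2, by omega⟩ ⟨c.1, hc⟩ ⟨a.1 - 2, by omega⟩ (base p)
      else 0

/-- The deformed Riemannian extension metric `g_{D,Φ}`:
`g_{ij} = Φ_{ij} − 2(x₁' Γ¹_{ij} + x₂' Γ²_{ij})`, `g_{i j'} = g_{j' i} = δ_i^j`, `g_{i'j'} = 0`. -/
def gDE (Γ : Fin 2 → Fin 2 → Fin 2 → Pt2 → ℝ) (Φ : Fin 2 → Fin 2 → Pt2 → ℝ)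
    (a b : Fin 4) (p : Pt4) : ℝ :=
  if ha : a.1 < 2 then
    if hb : b.1 < 2 then
      Φ ⟨a.1, ha⟩ ⟨b.1, hb⟩ (base p)
        - 2 * ∑ r : Fin 2, p (pr r) * Γ r ⟨a.1, ha⟩ ⟨b.1, hb⟩ (base p)
    else if b.1 = a.1 + 2 then 1 else 0
  else
    if b.1 < 2 then (if a.1 = b.1 + 2 then 1 else 0) else 0

/-- The Ricci tensor `ρ_{ab}` of `g_{D,Φ}`, computed from its Christoffel symbols. -/
def ricci4 (Γ : Fin 2 → Fin 2 → Fin 2 → Pt2 → ℝ) (Φ : Fin 2 → Fin 2 → Pt2 → ℝ)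
    (a b : Fin 4) (p : Pt4) : ℝ :=
  (∑ c : Fin 4, pd4 c (GG Γ Φ c a b) p) - pd4 a (fun q => ∑ c : Fin 4, GG Γ Φ c c b q) p
    + ∑ c : Fin 4, ∑ d : Fin 4,
        (GG Γ Φ c c d p * GG Γ Φ d a b p - GG Γ Φ c a d p * GG Γ Φ d c b p)

/-- The Hessian `Hes_f(∂_a,∂_b) = ∂_a∂_b f − Σ_c 𝚪^c_{ab} ∂_c f` on `T*Σ`. -/
def hess4 (Γ : Fin 2 → Fin 2 → Fin 2 → Pt2 → ℝ) (Φ : Fin 2 → Fin 2 → Pt2 → ℝ)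
    (f : Pt4 → ℝ) (a b : Fin 4) (p : Pt4) : ℝ :=
  pd4 a (pd4 b f) p - ∑ c : Fin 4, GG Γ Φ c a b p * pd4 c f p

/-- The Ricci tensor `ρ^D_{ij}` of the affine connection `D` on the surface. -/
def ricciD (Γ : Fin 2 → Fin 2 → Fin 2 → Pt2 → ℝ) (i j : Fin 2) (p : Pt2) : ℝ :=
  (∑ k : Fin 2, pd2 k (Γ k i j) p) - pd2 i (fun q => ∑ k : Fin 2, Γ k k j q) p
    + ∑ k : Fin 2, ∑ l : Fin 2, (Γ k k l p * Γ l i j p - Γ k i l p * Γ l k j p)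

/-- The symmetrized Ricci tensor `ρ^{D,sym}_{ij}` of `D`. -/
def ricciDSym (Γ : Fin 2 → Fin 2 → Fin 2 → Pt2 → ℝ) (i j : Fin 2) (p : Pt2) : ℝ :=
  (ricciD Γ i j p + ricciD Γ j i p) / 2

/-- The affine Hessian `Hes^D_h(∂_i,∂_j) = ∂_i∂_j h − Σ_k Γ^k_{ij} ∂_k h` on the surface. -/
def hessD (Γ : Fin 2 → Fin 2 → Fin 2 → Pt2 → ℝ) (h : Pt2 → ℝ) (i j : Fin 2) (p : Pt2) : ℝ :=
  pd2 i (pd2 j h) p - ∑ k : Fin 2, Γ k i j p * pd2 k h p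


/-- The zero section `x ↦ (x, 0)` of the cotangent bundle. -/
def zeroSection (x : Pt2) : Pt4 := ![x 0, x 1, 0, 0]

theorem base_zeroSection (x : Pt2) : base (zeroSection x) = x := by
  ext i
  fin_cases i <;> rfl

theorem contDiff_base {n : WithTop ℕ∞} : ContDiff ℝ n base := by
  refine contDiff_pi.2 fun i => ?_
  fin_cases i
  · exact contDiff_apply ℝ ℝ (0 : Fin 4)
  · exact contDiff_apply ℝ ℝ (1 : Fin 4)

theorem contDiff_zeroSection {n : WithTop ℕ∞} : ContDiff ℝ n zeroSection := by
  refine contDiff_pi.2 fun i => ?_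
  fin_cases i
  · exact contDiff_apply ℝ ℝ (0 : Fin 2)
  · exact contDiff_apply ℝ ℝ (1 : Fin 2)
  · exact contDiff_const
  · exact contDiff_const

theorem isOpen_base_preimage {U : Set Pt2} (hU : IsOpen U) : IsOpen {p : Pt4 | base p ∈ U} :=
  hU.preimage (contDiff_base (n := 0)).continuous

theorem contDiffOn_pd4 {s : Set Pt4} (hs : IsOpen s) {f : Pt4 → ℝ}
    (hf : ContDiffOn ℝ (⊤ : ℕ∞) f s) (a : Fin 4) : ContDiffOn ℝ (⊤ : ℕ∞) (pd4 a f) s :=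
  (hf.fderiv_of_isOpen hs (by simp)).clm_apply contDiffOn_const

/-- `𝚪^a_{i'j'} = 0`. -/
theorem GG_pr_pr (Γ : Fin 2 → Fin 2 → Fin 2 → Pt2 → ℝ) (Φ : Fin 2 → Fin 2 → Pt2 → ℝ)
    (a : Fin 4) (i j : Fin 2) : GG Γ Φ a (pr i) (pr j) = fun _ => 0 := by
  funext p
  simp [GG, pr]

/-- `𝚪^k_{aj'} = 0`. -/
theorem GG_pr_right_of_lt (Γ : Fin 2 → Fin 2 → Fin 2 → Pt2 → ℝ) (Φ : Fin 2 → Fin 2 → Pt2 → ℝ)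
    {k : Fin 4} (hk : k.1 < 2) (a : Fin 4) (j : Fin 2) : GG Γ Φ k a (pr j) = fun _ => 0 := by
  funext p
  simp [GG, pr, hk]

theorem GG_pr_right_of_le (Γ : Fin 2 → Fin 2 → Fin 2 → Pt2 → ℝ) (Φ : Fin 2 → Fin 2 → Pt2 → ℝ)
    (c : Fin 4) {a : Fin 4} (ha : 2 ≤ a.1) (j : Fin 2) : GG Γ Φ c a (pr j) = fun _ => 0 := by
  funext p
  simp [GG, pr, ha.not_gt]

theorem GG_pr_left_of_le (Γ : Fin 2 → Fin 2 → Fin 2 → Pt2 → ℝ) (Φ : Fin 2 → Fin 2 → Pt2 → ℝ)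
    (c : Fin 4) (i : Fin 2) {d : Fin 4} (hd : 2 ≤ d.1) : GG Γ Φ c (pr i) d = fun _ => 0 := by
  funext p
  simp [GG, pr, hd.not_gt]

/-- The Ricci tensor of a deformed Riemannian extension vanishes on the vertical distribution. -/
theorem ricci4_pr_pr (Γ : Fin 2 → Fin 2 → Fin 2 → Pt2 → ℝ) (Φ : Fin 2 → Fin 2 → Pt2 → ℝ)
    (i j : Fin 2) (p : Pt4) : ricci4 Γ Φ (pr i) (pr j) p = 0 := by
  have htrace (c : Fin 4) : GG Γ Φ c c (pr j) = fun _ => 0 := by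
    rcases lt_or_ge c.1 2 with hc | hc
    · exact GG_pr_right_of_lt Γ Φ hc c j
    · exact GG_pr_right_of_le Γ Φ c hc j
  have hquad (c d : Fin 4) : GG Γ Φ c (pr i) d p * GG Γ Φ d c (pr j) p = 0 := by
    rcases lt_or_ge d.1 2 with hd | hd
    · simp [GG_pr_right_of_lt Γ Φ hd c j]
    · simp [GG_pr_left_of_le Γ Φ c i hd]
  simp [ricci4, htrace, hquad, GG_pr_pr, pd4]

theorem hess4_pr_pr (Γ : Fin 2 → Fin 2 → Fin 2 → Pt2 → ℝ) (Φ : Fin 2 → Fin 2 → Pt2 → ℝ)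
    (f : Pt4 → ℝ) (i j : Fin 2) (p : Pt4) :
    hess4 Γ Φ f (pr i) (pr j) p = pd4 (pr i) (pd4 (pr j) f) p := by
  simp [hess4, GG_pr_pr]

theorem gDE_pr_pr (Γ : Fin 2 → Fin 2 → Fin 2 → Pt2 → ℝ) (Φ : Fin 2 → Fin 2 → Pt2 → ℝ)
    (i j : Fin 2) (p : Pt4) : gDE Γ Φ (pr i) (pr j) p = 0 := by
  simp [gDE, pr]

/-- A function whose fiber derivatives vanish over `U` is constant along the fibers over `U`. -/
theorem eq_zeroSection_of_pd4_pr_eq_zero {U : Set Pt2} {F : Pt4 → ℝ}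
    (hF : ∀ p, base p ∈ U → DifferentiableAt ℝ F p)
    (hF' : ∀ p, base p ∈ U → ∀ i, pd4 (pr i) F p = 0) {p : Pt4} (hp : base p ∈ U) :
    F p = F (zeroSection (base p)) := by
  let v : Pt4 := p 2 • Pi.single (pr 0) 1 + p 3 • Pi.single (pr 1) 1
  let γ : ℝ → Pt4 := fun t => zeroSection (base p) + t • v
  have hv : v = ![0, 0, p 2, p 3] := by
    ext k
    fin_cases k <;> simp [v, pr]
  have hbase (t : ℝ) : base (γ t) ∈ U := by
    have : base (γ t) = base p := by
      ext k
      fin_cases k <;> simp [γ, hv, base, zeroSection]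
    rwa [this]
  have hγ (t : ℝ) : HasDerivAt γ v t := by
    have h := ((hasDerivAt_id t).smul_const v).const_add (zeroSection (base p))
    rw [one_smul] at h
    exact h
  have hcomp (t : ℝ) : HasDerivAt (F ∘ γ) 0 t := by
    have h := (hF _ (hbase t)).hasFDerivAt.comp_hasDerivAt t (hγ t)
    have h0 := hF' _ (hbase t) 0
    have h1 := hF' _ (hbase t) 1
    simp only [pd4] at h0 h1
    simpa only [v, map_add, map_smul, h0, h1, smul_zero, add_zero] using h
  have hone : γ 1 = p := by
    ext k
    fin_cases k <;> simp [γ, hv, base, zeroSection]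
  have hzero : γ 0 = zeroSection (base p) := by simp [γ]
  have h := is_const_of_deriv_eq_zero (fun t => (hcomp t).differentiableAt)
    (fun t => (hcomp t).deriv) 1 0
  simpa only [Function.comp_apply, hone, hzero] using h

/-- A function with vanishing second fiber derivatives over `U` is affine along the fibers. -/
theorem eq_affine_of_pd4_pr_pd4_pr_eq_zero {U : Set Pt2} {f : Pt4 → ℝ}
    (hf : ∀ p, base p ∈ U → DifferentiableAt ℝ f p)
    (hf' : ∀ j p, base p ∈ U → DifferentiableAt ℝ (pd4 (pr j) f) p)
    (hf'' : ∀ p, base p ∈ U → ∀ i j, pd4 (pr i) (pd4 (pr j) f) p = 0)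
    {p : Pt4} (hp : base p ∈ U) :
    f p = p (pr 0) * pd4 (pr 0) f (zeroSection (base p))
      + p (pr 1) * pd4 (pr 1) f (zeroSection (base p)) + f (zeroSection (base p)) := by
  let F : Pt4 → ℝ := fun q => f q - (q (pr 0) * pd4 (pr 0) f q + q (pr 1) * pd4 (pr 1) f q)
  have hcoord (i : Fin 2) (q : Pt4) : HasFDerivAt (fun q : Pt4 => q (pr i))
      (ContinuousLinearMap.proj (R := ℝ) (φ := fun _ : Fin 4 => ℝ) (pr i)) q :=
    hasFDerivAt_apply (pr i) q
  have hFderiv (q : Pt4) (hq : base q ∈ U) :=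
    (hf q hq).hasFDerivAt.sub
      (((hcoord 0 q).mul (hf' 0 q hq).hasFDerivAt).add
        ((hcoord 1 q).mul (hf' 1 q hq).hasFDerivAt))
  have hFvert (q : Pt4) (hq : base q ∈ U) (i : Fin 2) : pd4 (pr i) F q = 0 := by
    have h0 := hf'' q hq i 0
    have h1 := hf'' q hq i 1
    simp only [pd4] at h0 h1
    have hfd : fderiv ℝ F q = _ := (hFderiv q hq).fderiv
    rw [pd4, hfd]
    fin_cases i <;> simp_all [pd4, pr]
  have hconst := eq_zeroSection_of_pd4_pr_eq_zero
    (fun q hq => (hFderiv q hq).differentiableAt) hFvert hp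
  have hg (j : Fin 2) : pd4 (pr j) f p = pd4 (pr j) f (zeroSection (base p)) :=
    eq_zeroSection_of_pd4_pr_eq_zero (hf' j) (fun q hq i => hf'' q hq i j) hp
  have hz0 : zeroSection (base p) (pr 0) = 0 := rfl
  have hz1 : zeroSection (base p) (pr 1) = 0 := rfl
  simp only [Pi.sub_apply, Pi.add_apply, Pi.mul_apply, hg, hz0, hz1] at hconst
  linarith

/-- If `(T*Σ, g_{D,Φ}, f)` satisfies the gradient Ricci soliton equation
`Hes_f(∂_a,∂_b) + ρ_{ab} = λ g_{ab}` on `U × ℝ²`, then `∂²f/∂x_{i'}∂x_{j'} = 0` and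
`f(x¹,x²,x₁',x₂') = x₁' X¹(x¹,x²) + x₂' X²(x¹,x²) + h(x¹,x²)` for smooth `X¹, X², h` on `U`. -/
theorem stmt3 (U : Set Pt2) (hU : IsOpen U) (hUconn : IsConnected U)
    (Γ : Fin 2 → Fin 2 → Fin 2 → Pt2 → ℝ)
    (hΓsmooth : ∀ k i j, ContDiffOn ℝ (⊤ : ℕ∞) (Γ k i j) U)
    (hΓsym : ∀ k i j, Γ k i j = Γ k j i)
    (Φ : Fin 2 → Fin 2 → Pt2 → ℝ)
    (hΦsmooth : ∀ i j, ContDiffOn ℝ (⊤ : ℕ∞) (Φ i j) U)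
    (hΦsym : ∀ i j, Φ i j = Φ j i)
    (f : Pt4 → ℝ) (hf : ContDiffOn ℝ (⊤ : ℕ∞) f {p : Pt4 | base p ∈ U}) (lam : ℝ)
    (hsol : ∀ p : Pt4, base p ∈ U → ∀ a b : Fin 4,
      hess4 Γ Φ f a b p + ricci4 Γ Φ a b p = lam * gDE Γ Φ a b p) :
    (∀ p : Pt4, base p ∈ U → ∀ i j : Fin 2, pd4 (pr i) (pd4 (pr j) f) p = 0) ∧
    ∃ X1 X2 h : Pt2 → ℝ, ContDiffOn ℝ (⊤ : ℕ∞) X1 U ∧ ContDiffOn ℝ (⊤ : ℕ∞) X2 U ∧ ContDiffOn ℝ (⊤ : ℕ∞) h U ∧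
      ∀ p : Pt4, base p ∈ U →
        f p = p (pr 0) * X1 (base p) + p (pr 1) * X2 (base p) + h (base p) := by
  have hopen := isOpen_base_preimage hU
  have hvert (p : Pt4) (hp : base p ∈ U) (i j : Fin 2) :
      pd4 (pr i) (pd4 (pr j) f) p = 0 := by
    simpa [hess4_pr_pr, ricci4_pr_pr, gDE_pr_pr] using hsol p hp (pr i) (pr j)
  have hpd (a : Fin 4) := contDiffOn_pd4 hopen hf a
  have hdiff {F : Pt4 → ℝ} (hF : ContDiffOn ℝ (⊤ : ℕ∞) F {p : Pt4 | base p ∈ U}) (p : Pt4)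
      (hp : base p ∈ U) : DifferentiableAt ℝ F p :=
    (hF.differentiableOn (by simp)).differentiableAt (hopen.mem_nhds hp)
  have hrestrict {F : Pt4 → ℝ} (hF : ContDiffOn ℝ (⊤ : ℕ∞) F {p : Pt4 | base p ∈ U}) :
      ContDiffOn ℝ (⊤ : ℕ∞) (F ∘ zeroSection) U :=
    hF.comp contDiff_zeroSection.contDiffOn fun x hx => by simpa [base_zeroSection] using hx
  exact ⟨hvert, _, _, _, hrestrict (hpd (pr 0)), hrestrict (hpd (pr 1)), hrestrict hf,
    fun p hp => eq_affine_of_pd4_pr_pd4_pr_eq_zero (hdiff hf) (fun j => hdiff (hpd (pr j)))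
      hvert hp⟩


end
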